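/- Assume f and g are twice continuously differentiable and Assumption (A) holds. Then the MPEC no-nonzero-abnormal-multiplier constraint qualification fails at every feasible point of SVF: for every (x̄,ȳ,ū,s̄) ∈ F_S there exist λ₀ ≥ 0, λ ∈ ℝ^m with λ_i ≥ 0 and λ_i = 0 for i ∉ I(x̄,ȳ), μ_φ ∈ ℝ^l, and μ^g ∈ ℝ^m with μ^g_i = 0 for i ∉ I(x̄,ū), not all zero, such that: 0 = λ₀(∇₁f(x̄,ȳ) − ∇₁f(x̄,ū)) + Σ_{i∈I(x̄,ȳ)} λ_i ∇₁g_i(x̄,ȳ) + [∇₂₁²f + Σ_{i∈I(x̄,ū)} s̄_i ∇₂₁²g_i](x̄,ū)ᵀμ_φ + Σ_{i∈I(x̄,ū)} μ^g_i ∇₁g_i(x̄,ū); 0 = λ₀∇₂f(x̄,ȳ) + Σ_{i∈I(x̄,ȳ)} λ_i ∇₂g_i(x̄,ȳ); 0 = −λ₀∇₂f(x̄,ū) + Σ_{i∈I(x̄,ū)} μ^g_i ∇₂g_i(x̄,ū) + [∇₂₂²f + Σ_{i∈I(x̄,ū)} s̄_i ∇₂₂²g_i](x̄,ū)ᵀμ_φ;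 ⟨∇₂g_i(x̄,ū), μ_φ⟩ = 0 for all i ∈ I_g(x̄,ū); and for every i ∈ I_0(x̄,ū), either (μ^g_i > 0 and ⟨∇₂g_i(x̄,ū), μ_φ⟩ > 0) or μ^g_i·⟨∇₂g_i(x̄,ū), μ_φ⟩ = 0. -/

import Mathlib

open scoped InnerProductSpace
open Filter Topology

noncomputable section

/-- Euclidean space ℝ^n. -/
abbrev E (n : ℕ) : Type := EuclideanSpace ℝ (Fin n)

variable {d l m : ℕ}

/-- Gradient with respect to the first argument. -/
noncomputable def grad1 (f : E d × E l → ℝ) (x : E d) (y : E l) : E d :=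
  gradient (fun x' => f (x', y)) x

/-- Gradient with respect to the second argument. -/
noncomputable def grad2 (f : E d × E l → ℝ) (x : E d) (y : E l) : E l :=
  gradient (fun y' => f (x, y')) y

/-- The lower level feasible set `Y(x) = {y : g(x,y) ≤ 0}`. -/
def Yset (g : Fin m → E d × E l → ℝ) (x : E d) : Set (E l) :=
  {y | ∀ i, g i (x, y) ≤ 0}

/-- The lower level solution set `S(x)`. -/
def Sset (f : E d × E l → ℝ) (g : Fin m → E d × E l → ℝ) (x : E d) : Set (E l) :=
  {y | y ∈ Yset g x ∧ ∀ y' ∈ Yset g x, f (x, y) ≤ f (x, y')}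

/-- The lower level Lagrangian `L(x,u,s) = f(x,u) + Σᵢ sᵢ gᵢ(x,u)`. -/
noncomputable def Lag (f : E d × E l → ℝ) (g : Fin m → E d × E l → ℝ)
    (x : E d) (u : E l) (s : Fin m → ℝ) : ℝ :=
  f (x, u) + ∑ i, s i * g i (x, u)

/-- The lower level multiplier set `M(x,u)`. -/
def Mset (f : E d × E l → ℝ) (g : Fin m → E d × E l → ℝ) (x : E d) (u : E l) :
    Set (Fin m → ℝ) :=
  {s | grad2 f x u + ∑ i, s i • grad2 (g i) x u = 0 ∧ (∀ i, 0 ≤ s i) ∧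
       ∑ i, s i * g i (x, u) = 0}

/-- Assumption (A): pseudoconvexity of the lower level Lagrangian. -/
def AssumptionA (f : E d × E l → ℝ) (g : Fin m → E d × E l → ℝ) : Prop :=
  ∀ (x : E d), ∀ u1 ∈ Yset g x, ∀ u2 ∈ Yset g x, ∀ s ∈ Mset f g x u2,
    0 ≤ ⟪u1 - u2, gradient (fun u' => Lag f g x u' s) u2⟫_ℝ →
    Lag f g x u2 s ≤ Lag f g x u1 s

/-- The lower level KKT conditions at `(x,u)` with multiplier `s`. -/
def LLKKT (f : E d × E l → ℝ) (g : Fin m → E d × E l → ℝ)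
    (x : E d) (u : E l) (s : Fin m → ℝ) : Prop :=
  grad2 f x u + ∑ i, s i • grad2 (g i) x u = 0 ∧
  ∀ i, 0 ≤ s i ∧ g i (x, u) ≤ 0 ∧ s i * g i (x, u) = 0

/-- Membership in the feasible set `F_S` of the SVF formulation. -/
def FSmem (f : E d × E l → ℝ) (g : Fin m → E d × E l → ℝ)
    (x : E d) (y u : E l) (s : Fin m → ℝ) : Prop :=
  f (x, y) - f (x, u) ≤ 0 ∧ LLKKT f g x u s ∧ ∀ i, g i (x, y) ≤ 0

/-- The value function `V(x) = inf {f(x,y) : y ∈ Y(x)}`. -/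
noncomputable def Vval (f : E d × E l → ℝ) (g : Fin m → E d × E l → ℝ) (x : E d) : ℝ :=
  sInf ((fun y => f (x, y)) '' Yset g x)

/-- Smoothness data: `f`, `g` are `C¹` jointly, and `C²` in the second variable. -/
def SmoothData (f : E d × E l → ℝ) (g : Fin m → E d × E l → ℝ) : Prop :=
  ContDiff ℝ 1 f ∧ (∀ i, ContDiff ℝ 1 (g i)) ∧
  (∀ x : E d, ContDiff ℝ 2 (fun y : E l => f (x, y))) ∧
  ∀ i, ∀ x : E d, ContDiff ℝ 2 (fun y : E l => g i (x, y))

/-- `[∇₂₁²f + Σᵢ cᵢ ∇₂₁²gᵢ](x,u)ᵀμ`: the gradient at `x` of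
`x' ↦ ⟪∇₂f(x',u) + Σᵢ cᵢ ∇₂gᵢ(x',u), μ⟫` with `u` fixed. -/
noncomputable def grad21 (f : E d × E l → ℝ) (g : Fin m → E d × E l → ℝ)
    (c : Fin m → ℝ) (μ : E l) (x : E d) (u : E l) : E d :=
  gradient (fun x' => ⟪grad2 f x' u + ∑ i, c i • grad2 (g i) x' u, μ⟫_ℝ) x

/-- `[∇₂₂²f + Σᵢ cᵢ ∇₂₂²gᵢ](x,u)ᵀμ`: the gradient at `u` of
`u' ↦ ⟪∇₂f(x,u') + Σᵢ cᵢ ∇₂gᵢ(x,u'), μ⟫` with `x` fixed. -/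
noncomputable def grad22 (f : E d × E l → ℝ) (g : Fin m → E d × E l → ℝ)
    (c : Fin m → ℝ) (μ : E l) (x : E d) (u : E l) : E l :=
  gradient (fun u' => ⟪grad2 f x u' + ∑ i, c i • grad2 (g i) x u', μ⟫_ℝ) u

/-- The three W-stationarity gradient equations of SVF at `(x,y,u,s)` with multipliers
`(lam0, lam, muphi, mug)`; the sums over active index sets are written as full sums,
the multipliers being required (separately) to vanish off the active sets. -/
noncomputable def WStatEqs (F f : E d × E l → ℝ) (g : Fin m → E d × E l → ℝ)
    (x : E d) (y u : E l) (s : Fin m → ℝ)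
    (lam0 : ℝ) (lam : Fin m → ℝ) (muphi : E l) (mug : Fin m → ℝ) : Prop :=
  grad1 F x y + lam0 • (grad1 f x y - grad1 f x u) + ∑ i, lam i • grad1 (g i) x y
      + grad21 f g s muphi x u + ∑ i, mug i • grad1 (g i) x u = 0 ∧
  grad2 F x y + lam0 • grad2 f x y + ∑ i, lam i • grad2 (g i) x y = 0 ∧
  -(lam0 • grad2 f x u) + ∑ i, mug i • grad2 (g i) x u + grad22 f g s muphi x u = 0

theorem Ultrafilter.exists_tendsto_of_mem_isCompact {α X : Type*} [TopologicalSpace X]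
    {K : Set X} (hK : IsCompact K) (U : Ultrafilter α) {z : α → X} (hz : ∀ a, z a ∈ K) :
    ∃ x ∈ K, Tendsto z U (𝓝 x) :=
  hK.ultrafilter_le_nhds (U.map z) (le_principal_iff.2 (Ultrafilter.mem_map.2
    (Filter.univ_mem' hz)))

/-- First-order necessary condition along a one-sided feasible direction. -/
theorem IsMinOn.fderiv_apply_nonneg {Z : Type*} [NormedAddCommGroup Z] [NormedSpace ℝ Z]
    {Φ : Z → ℝ} {s : Set Z} {z v : Z} (hmin : IsMinOn Φ s z) (hd : DifferentiableAt ℝ Φ z)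
    (hv : ∀ᶠ t : ℝ in 𝓝[>] 0, z + t • v ∈ s) : 0 ≤ fderiv ℝ Φ z v := by
  have h := (hd.hasFDerivAt.hasLineDerivAt v).tendsto_slope_zero_right
  refine ge_of_tendsto h ?_
  filter_upwards [hv, self_mem_nhdsWithin] with t ht ht0
  have h1 : Φ z ≤ Φ (z + t • v) := hmin ht
  have h2 : (0 : ℝ) < t := ht0
  simp only [smul_eq_mul]
  exact mul_nonneg (inv_nonneg.2 h2.le) (sub_nonneg.2 h1)

/-- Minimizers of the quadratic penalization of an equality-constrained problem, localized by a
proximal term `ψ`, cluster only at the constrained minimizer. -/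
theorem exists_penalty_minimizers {Z ι : Type*} [Fintype ι] [NormedAddCommGroup Z]
    [NormedSpace ℝ Z] [FiniteDimensional ℝ Z] {obj ψ : Z → ℝ} {h : ι → Z → ℝ} {s : Set Z} {zb : Z}
    (hobj : Continuous obj) (hh : ∀ i, Continuous (h i)) (hψ : Continuous ψ)
    (hψ0 : ∀ z, 0 ≤ ψ z) (hψz : ∀ z, ψ z = 0 ↔ z = zb)
    (hs : IsClosed s) (hzb : zb ∈ s) (hhzb : ∀ i, h i zb = 0)
    (hmin : ∀ z ∈ s, (∀ i, h i z = 0) → obj zb ≤ obj z) (U : Ultrafilter ℕ) (hU : (U : Filter ℕ) ≤ atTop) :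
    ∃ z : ℕ → Z, Tendsto z U (𝓝 zb) ∧ ∀ k, z k ∈ s ∧
      IsMinOn (fun x => obj x + (k / 2 : ℝ) * ∑ i, h i x ^ 2 + ψ x)
        (s ∩ Metric.closedBall zb 1) (z k) := by
  have hK : IsCompact (s ∩ Metric.closedBall zb 1) :=
    (isCompact_closedBall zb 1).inter_left hs
  have hzbK : zb ∈ s ∩ Metric.closedBall zb 1 := ⟨hzb, by simp⟩
  have hex : ∀ k : ℕ, ∃ x ∈ s ∩ Metric.closedBall zb 1,
      IsMinOn (fun x => obj x + (k / 2 : ℝ) * ∑ i, h i x ^ 2 + ψ x)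
        (s ∩ Metric.closedBall zb 1) x := fun k =>
    hK.exists_isMinOn ⟨zb, hzbK⟩ (by fun_prop)
  choose z hzK hzmin using hex
  refine ⟨z, ?_, fun k => ⟨(hzK k).1, hzmin k⟩⟩
  obtain ⟨x, hxK, hx⟩ := U.exists_tendsto_of_mem_isCompact hK hzK
  have hval : ∀ k : ℕ, obj (z k) + (k / 2 : ℝ) * ∑ i, h i (z k) ^ 2 + ψ (z k) ≤ obj zb := by
    intro k
    have := hzmin k hzbK
    simpa [hhzb, (hψz zb).2 rfl] using this
  have hpen0 : ∀ y : Z, 0 ≤ ∑ i, h i y ^ 2 := fun y => Finset.sum_nonneg fun i _ => sq_nonneg _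
  have hcont : Continuous fun y => ∑ i, h i y ^ 2 := by fun_prop
  have hpen : ∑ i, h i x ^ 2 = 0 := by
    refine le_antisymm ?_ (hpen0 x)
    by_contra! hpos
    have h1 : Tendsto (fun k : ℕ => (k / 2 : ℝ) * ∑ i, h i (z k) ^ 2) U atTop := by
      refine Tendsto.atTop_mul_pos hpos ?_ ((hcont.tendsto x).comp hx)
      exact (tendsto_natCast_atTop_atTop.atTop_div_const two_pos).mono_left hU
    have h2 : Tendsto (fun k : ℕ => obj zb - obj (z k)) U (𝓝 (obj zb - obj x)) :=
      tendsto_const_nhds.sub ((hobj.tendsto x).comp hx)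
    refine not_tendsto_atTop_of_tendsto_nhds h2 (tendsto_atTop_mono (fun k => ?_) h1)
    linarith [hval k, hψ0 (z k)]
  have hfeas : ∀ i, h i x = 0 := fun i => by
    simpa using (Finset.sum_eq_zero_iff_of_nonneg fun i _ => sq_nonneg (h i x)).1 hpen i
      (Finset.mem_univ i)
  have hlim : obj x + ψ x ≤ obj zb := by
    refine le_of_tendsto (((hobj.add hψ).tendsto x).comp hx) (Eventually.of_forall fun k => ?_)
    have : 0 ≤ (k / 2 : ℝ) * ∑ i, h i (z k) ^ 2 := mul_nonneg (by positivity) (hpen0 _)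
    simp only [Function.comp, Pi.add_apply]
    linarith [hval k]
  have : x = zb := (hψz x).1 (le_antisymm (by linarith [hmin x hxK.1 hfeas]) (hψ0 x))
  rwa [this] at hx

/-- Approximate Fritz John conditions: at a minimizer of `obj` over `{z ∈ s | h z = 0}` there is a
nontrivial multiplier whose Lagrangian derivative is a limit of functionals that are nonnegative
along the feasible directions of `s` at nearby points of `s`. -/
theorem exists_fritzJohn_multipliers {Z ι : Type*} [Fintype ι] [NormedAddCommGroup Z]
    [NormedSpace ℝ Z] [FiniteDimensional ℝ Z] {obj : Z → ℝ} {h : ι → Z → ℝ} {s : Set Z} {zb : Z}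
    (hobj : ContDiff ℝ 1 obj) (hh : ∀ i, ContDiff ℝ 1 (h i))
    (hs : IsClosed s) (hzb : zb ∈ s) (hhzb : ∀ i, h i zb = 0)
    (hmin : ∀ z ∈ s, (∀ i, h i z = 0) → obj zb ≤ obj z) :
    ∃ (c : ℝ) (w : ι → ℝ) (U : Ultrafilter ℕ) (z : ℕ → Z) (ξ : ℕ → Z →L[ℝ] ℝ),
      0 ≤ c ∧ (c, w) ≠ 0 ∧ Tendsto z U (𝓝 zb) ∧ (∀ k, z k ∈ s) ∧
      (∀ v, Tendsto (fun k => ξ k v) U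
        (𝓝 (fderiv ℝ (fun x => c * obj x + ∑ i, w i * h i x) zb v))) ∧
      ∀ᶠ k in U, ∀ v, (∀ᶠ t : ℝ in 𝓝[>] 0, z k + t • v ∈ s) → 0 ≤ ξ k v := by
  set ψ : Z → ℝ := fun z => ‖toEuclidean (z - zb)‖ ^ 2 with hψdef
  have hψ : ContDiff ℝ 1 ψ := by
    refine ContDiff.norm_sq ℝ ?_
    exact toEuclidean.contDiff.comp (contDiff_id.sub contDiff_const)
  have hψ0 : ∀ z, 0 ≤ ψ z := fun z => sq_nonneg _
  have hψz : ∀ z, ψ z = 0 ↔ z = zb := fun z => by simp [hψdef, sub_eq_zero]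
  have hψzb : fderiv ℝ ψ zb = 0 := by
    refine IsLocalMin.fderiv_eq_zero (Eventually.of_forall fun z => ?_)
    rw [(hψz zb).2 rfl]
    exact hψ0 z
  set U : Ultrafilter ℕ := hyperfilter ℕ
  obtain ⟨z, hz, hzs⟩ := exists_penalty_minimizers hobj.continuous (fun i => (hh i).continuous)
    hψ.continuous hψ0 hψz hs hzb hhzb hmin U (Nat.hyperfilter_le_atTop)
  have dobj : Differentiable ℝ obj := hobj.differentiable one_ne_zero
  have dh : ∀ i, Differentiable ℝ (h i) := fun i => (hh i).differentiable one_ne_zero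
  have dψ : Differentiable ℝ ψ := hψ.differentiable one_ne_zero
  set p : ℕ → ℝ × (ι → ℝ) := fun k => (1, fun i => k * h i (z k)) with hp
  have hr : ∀ k, 1 ≤ ‖p k‖ := fun k => by
    simp [hp]
  have hrpos : ∀ k, 0 < ‖p k‖ := fun k => one_pos.trans_le (hr k)
  set q : ℕ → ℝ × (ι → ℝ) := fun k => ‖p k‖⁻¹ • p k with hq
  have hq1 : ∀ k, (q k).1 = ‖p k‖⁻¹ := fun k => mul_one _
  have hq2 : ∀ k i, (q k).2 i = ‖p k‖⁻¹ * (k * h i (z k)) := fun k i => rfl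
  have hqs : ∀ k, q k ∈ Metric.sphere (0 : ℝ × (ι → ℝ)) 1 := fun k => by
    simp [hq, norm_smul, (hrpos k).ne']
  obtain ⟨⟨c, w⟩, hcw, hlim⟩ := U.exists_tendsto_of_mem_isCompact (isCompact_sphere _ _) hqs
  have hlim1 : Tendsto (fun k => (q k).1) U (𝓝 c) := hlim.fst_nhds
  have hlim2 : ∀ i, Tendsto (fun k => (q k).2 i) U (𝓝 (w i)) := fun i =>
    tendsto_pi_nhds.1 hlim.snd_nhds i
  refine ⟨c, w, U, z, fun k => ‖p k‖⁻¹ • fderiv ℝ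
    (fun x => obj x + (k / 2 : ℝ) * ∑ i, h i x ^ 2 + ψ x) (z k), ?_, ?_, hz,
    fun k => (hzs k).1, fun v => ?_, ?_⟩
  · refine ge_of_tendsto hlim1 (Eventually.of_forall fun k => ?_)
    simp [hq, hp]
  · intro h0
    simp [h0] at hcw
  · have hΛ : HasFDerivAt (fun x => c * obj x + ∑ i, w i * h i x)
        (c • fderiv ℝ obj zb + ∑ i, w i • fderiv ℝ (h i) zb) zb :=
      ((dobj zb).hasFDerivAt.const_mul c).add
        (HasFDerivAt.fun_sum fun i _ => ((dh i zb).hasFDerivAt.const_mul (w i)))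
    have hΦ : ∀ k : ℕ, HasFDerivAt (fun x => obj x + (k / 2 : ℝ) * ∑ i, h i x ^ 2 + ψ x)
        (fderiv ℝ obj (z k) + (k / 2 : ℝ) • ∑ i, (2 * h i (z k)) • fderiv ℝ (h i) (z k)
          + fderiv ℝ ψ (z k)) (z k) := fun k => by
      refine (((dobj (z k)).hasFDerivAt.add
        (HasFDerivAt.const_mul (HasFDerivAt.fun_sum fun i _ => ?_) _))).add (dψ (z k)).hasFDerivAt
      simpa using (dh i (z k)).hasFDerivAt.pow 2
    have hcd : ∀ {φ : Z → ℝ}, ContDiff ℝ 1 φ →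
        Tendsto (fun k => fderiv ℝ φ (z k) v) U (𝓝 (fderiv ℝ φ zb v)) := fun hφ =>
      ((((hφ.continuous_fderiv one_ne_zero).clm_apply continuous_const).tendsto zb).comp hz)
    have hψlim : Tendsto (fun k => ‖p k‖⁻¹ * fderiv ℝ ψ (z k) v) U (𝓝 0) := by
      have h1 : Tendsto (fun k => |fderiv ℝ ψ (z k) v|) U (𝓝 0) := by
        simpa [hψzb] using (hcd hψ).abs
      refine squeeze_zero_norm (fun k => ?_) h1
      rw [norm_mul, Real.norm_eq_abs, Real.norm_eq_abs, abs_of_pos (inv_pos.2 (hrpos k))]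
      exact mul_le_of_le_one_left (abs_nonneg _) (inv_le_one_of_one_le₀ (hr k))
    have hmain := ((hlim1.mul (hcd hobj)).add
      (tendsto_finsetSum Finset.univ fun i _ => (hlim2 i).mul (hcd (hh i)))).add hψlim
    rw [hΛ.fderiv]
    simp only [(hΦ _).fderiv]
    convert hmain using 2
    · simp only [smul_apply, add_apply,
        sum_apply, smul_eq_mul, mul_add, Finset.mul_sum, hq1, hq2]
      refine congrArg₂ _ (congrArg₂ _ rfl (Finset.sum_congr rfl fun i _ => ?_)) rfl
      ring
    · simp
  · filter_upwards [hz (Metric.ball_mem_nhds zb one_pos)] with k hk v hv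
    have hk' : z k ∈ Metric.ball zb 1 := hk
    refine mul_nonneg (inv_nonneg.2 (norm_nonneg _)) ?_
    refine (hzs k).2.fderiv_apply_nonneg ?_ ?_
    · have := dobj (z k)
      have := fun i => dh i (z k)
      have := dψ (z k)
      fun_prop
    · have hc : Tendsto (fun t : ℝ => z k + t • v) (𝓝[>] 0) (𝓝 (z k)) := by
        have : Continuous fun t : ℝ => z k + t • v := by fun_prop
        simpa using (this.tendsto 0).mono_left nhdsWithin_le_nhds
      filter_upwards [hv, hc (Metric.isOpen_ball.mem_nhds hk')] with t h1 h2
      exact ⟨h1, Metric.ball_subset_closedBall h2⟩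

theorem contDiff_grad2 {d l : ℕ} {f : E d × E l → ℝ} (hf : ContDiff ℝ 2 f) :
    ContDiff ℝ 1 (fun p : E d × E l => grad2 f p.1 p.2) := by
  have h1 : (fun p : E d × E l => grad2 f p.1 p.2) = fun p =>
      (InnerProductSpace.toDual ℝ (E l)).symm
        ((fderiv ℝ f p).comp (ContinuousLinearMap.inr ℝ (E d) (E l))) := by
    funext p
    have h2 : HasFDerivAt (fun y' => f (p.1, y'))
        ((fderiv ℝ f p).comp (ContinuousLinearMap.inr ℝ (E d) (E l))) p.2 :=
      HasFDerivAt.comp p.2 (g := f) (f := fun y' => (p.1, y'))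
        ((hf.differentiable two_ne_zero) p).hasFDerivAt (hasFDerivAt_prodMk_right p.1 p.2)
    simp only [grad2, gradient, h2.fderiv]
  rw [h1]
  refine (InnerProductSpace.toDual ℝ (E l)).symm.contDiff.comp ?_
  exact (hf.fderiv_right (m := 1) (by norm_num)).clm_comp contDiff_const

/-- Gradient in `u` of the lower level Lagrangian. -/
def lagGrad {d l m : ℕ} (f : E d × E l → ℝ) (g : Fin m → E d × E l → ℝ)
    (x : E d) (u : E l) (s : Fin m → ℝ) : E l :=
  grad2 f x u + ∑ i, s i • grad2 (g i) x u

theorem gradient_lag {d l m : ℕ} {f : E d × E l → ℝ} {g : Fin m → E d × E l → ℝ}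
    (hf : ContDiff ℝ 2 f) (hg : ∀ i, ContDiff ℝ 2 (g i)) (x : E d) (u : E l) (s : Fin m → ℝ) :
    gradient (fun u' => Lag f g x u' s) u = lagGrad f g x u s := by
  have hd : ∀ {φ : E d × E l → ℝ}, ContDiff ℝ 2 φ → HasFDerivAt (fun u' => φ (x, u'))
      (InnerProductSpace.toDual ℝ (E l) (grad2 φ x u)) u := fun {φ} hφ => by
    have h1 : DifferentiableAt ℝ (fun u' => φ (x, u')) u := by
      have := hφ.differentiable two_ne_zero
      fun_prop
    exact h1.hasGradientAt.hasFDerivAt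
  refine HasGradientAt.gradient (hasGradientAt_iff_hasFDerivAt.2 ?_)
  have h := (hd hf).add (HasFDerivAt.fun_sum (u := Finset.univ) fun i _ =>
    (hd (hg i)).const_mul (s i))
  refine HasFDerivAt.congr_fderiv h ?_
  simp [lagGrad]

/-- Under pseudoconvexity of the Lagrangian, KKT points are global lower level minimizers. -/
theorem AssumptionA.le_of_llkkt {d l m : ℕ} {f : E d × E l → ℝ} {g : Fin m → E d × E l → ℝ}
    (hA : AssumptionA f g) (hf : ContDiff ℝ 2 f) (hg : ∀ i, ContDiff ℝ 2 (g i))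
    {x : E d} {y u : E l} {s : Fin m → ℝ} (h : LLKKT f g x u s) (hy : y ∈ Yset g x) :
    f (x, u) ≤ f (x, y) := by
  have hsum : ∑ i, s i * g i (x, u) = 0 := Finset.sum_eq_zero fun i _ => (h.2 i).2.2
  have h1 := hA x y hy u (fun i => (h.2 i).2.1) s ⟨h.1, fun i => (h.2 i).1, hsum⟩ (by
    rw [gradient_lag hf hg, lagGrad, h.1, inner_zero_right])
  have h2 : ∑ i, s i * g i (x, y) ≤ 0 :=
    Finset.sum_nonpos fun i _ => mul_nonpos_of_nonneg_of_nonpos (h.2 i).1 (hy i)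
  simp only [Lag, hsum] at h1
  linarith

/-- The variables `(x, y, u, s, a, b)` of SVF, with slacks `a` for the constraints at `u` and `b`
for the constraints at `y`. -/
abbrev SVFSpace (d l m : ℕ) : Type :=
  E d × E l × E l × (Fin m → ℝ) × (Fin m → ℝ) × (Fin m → ℝ)

/-- Sign and complementarity conditions on the multiplier and the slacks. -/
def svfCone (d l m : ℕ) : Set (SVFSpace d l m) :=
  {z | ∀ i, 0 ≤ z.2.2.2.1 i ∧ 0 ≤ z.2.2.2.2.1 i ∧ z.2.2.2.1 i * z.2.2.2.2.1 i = 0 ∧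
    0 ≤ z.2.2.2.2.2 i}

theorem isClosed_svfCone (d l m : ℕ) : IsClosed (svfCone d l m) := by
  simp only [svfCone, Set.ofPred_forall, Set.ofPred_and]
  refine isClosed_iInter fun i => ?_
  refine (isClosed_le ?_ ?_).inter ((isClosed_le ?_ ?_).inter
    ((isClosed_eq ?_ ?_).inter (isClosed_le ?_ ?_))) <;> fun_prop

/-- The equality constraints of SVF with slacks. -/
def svfConstraint {d l m : ℕ} (f : E d × E l → ℝ) (g : Fin m → E d × E l → ℝ) :
    Fin l ⊕ Fin m ⊕ Fin m → SVFSpace d l m → ℝ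
  | .inl j, z => lagGrad f g z.1 z.2.2.1 z.2.2.2.1 j
  | .inr (.inl i), z => g i (z.1, z.2.2.1) + z.2.2.2.2.1 i
  | .inr (.inr i), z => g i (z.1, z.2.1) + z.2.2.2.2.2 i

/-- The Fritz John Lagrangian of SVF with slacks. -/
def svfLag {d l m : ℕ} (f : E d × E l → ℝ) (g : Fin m → E d × E l → ℝ) (c : ℝ)
    (lam : Fin m → ℝ) (μ : E l) (mug : Fin m → ℝ) (z : SVFSpace d l m) : ℝ :=
  c * (f (z.1, z.2.1) - f (z.1, z.2.2.1)) + ∑ i, lam i * (g i (z.1, z.2.1) + z.2.2.2.2.2 i)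
    + ⟪lagGrad f g z.1 z.2.2.1 z.2.2.2.1, μ⟫_ℝ
    + ∑ i, mug i * (g i (z.1, z.2.2.1) + z.2.2.2.2.1 i)

section Smooth

variable {d l m : ℕ} {f : E d × E l → ℝ} {g : Fin m → E d × E l → ℝ}

theorem contDiff_lagGrad (hf : ContDiff ℝ 2 f) (hg : ∀ i, ContDiff ℝ 2 (g i)) :
    ContDiff ℝ 1 (fun p : E d × E l × (Fin m → ℝ) => lagGrad f g p.1 p.2.1 p.2.2) := by
  have hcomp : ∀ {φ : E d × E l → ℝ}, ContDiff ℝ 2 φ →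
      ContDiff ℝ 1 (fun p : E d × E l × (Fin m → ℝ) => grad2 φ p.1 p.2.1) := fun hφ =>
    (contDiff_grad2 hφ).comp (g := fun p : E d × E l => grad2 _ p.1 p.2)
      (f := fun p : E d × E l × (Fin m → ℝ) => (p.1, p.2.1)) (by fun_prop)
  refine (hcomp hf).add (ContDiff.sum fun i _ => ContDiff.fun_smul ?_ (hcomp (hg i)))
  fun_prop

theorem contDiff_svfConstraint (hf : ContDiff ℝ 2 f) (hg : ∀ i, ContDiff ℝ 2 (g i))
    (k : Fin l ⊕ Fin m ⊕ Fin m) : ContDiff ℝ 1 (svfConstraint f g k) := by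
  have hg1 : ∀ i, ContDiff ℝ 1 (g i) := fun i => (hg i).of_le one_le_two
  rcases k with j | i | i <;> unfold svfConstraint
  · have h1 : ContDiff ℝ 1 (fun z : SVFSpace d l m => lagGrad f g z.1 z.2.2.1 z.2.2.2.1) :=
      (contDiff_lagGrad hf hg).comp (f := fun z : SVFSpace d l m => (z.1, z.2.2.1, z.2.2.2.1))
        (by fun_prop)
    exact contDiff_euclidean.1 h1 j
  · have := hg1 i
    fun_prop
  · have := hg1 i
    fun_prop

theorem differentiable_svfLag (hf : ContDiff ℝ 2 f) (hg : ∀ i, ContDiff ℝ 2 (g i)) (c : ℝ)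
    (lam : Fin m → ℝ) (μ : E l) (mug : Fin m → ℝ) :
    Differentiable ℝ (svfLag f g c lam μ mug) := by
  have hf1 := hf.differentiable two_ne_zero
  have hg1 := fun i => (hg i).differentiable two_ne_zero
  have h1 : Differentiable ℝ (fun z : SVFSpace d l m => lagGrad f g z.1 z.2.2.1 z.2.2.2.1) :=
    ((contDiff_lagGrad hf hg).differentiable one_ne_zero).comp
      (f := fun z : SVFSpace d l m => (z.1, z.2.2.1, z.2.2.2.1)) (by fun_prop)
  have h2 := h1.inner ℝ (differentiable_const (c := μ))
  unfold svfLag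
  fun_prop

theorem svfLag_eq (c : ℝ) (w : Fin l ⊕ Fin m ⊕ Fin m → ℝ) :
    (fun z : SVFSpace d l m => c * (f (z.1, z.2.1) - f (z.1, z.2.2.1))
      + ∑ k, w k * svfConstraint f g k z) =
    svfLag f g c (fun i => w (.inr (.inr i))) (WithLp.toLp 2 fun j => w (.inl j))
      (fun i => w (.inr (.inl i))) := by
  funext z
  simp only [svfLag, svfConstraint, Fintype.sum_sum_type, PiLp.inner_apply, RCLike.inner_apply,
    conj_trivial]
  ring

variable {c : ℝ} {lam mug : Fin m → ℝ} {μ : E l} {x : E d} {y u : E l} {s a b : Fin m → ℝ}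

theorem fderiv_apply_eq_of_line {Z : Type*} [NormedAddCommGroup Z] [NormedSpace ℝ Z] {Φ : Z → ℝ}
    {z v : Z} {r : ℝ} (hd : DifferentiableAt ℝ Φ z) (h : ∀ t : ℝ, Φ (z + t • v) = Φ z + t * r) :
    fderiv ℝ Φ z v = r := by
  rw [← hd.lineDeriv_eq_fderiv, lineDeriv]
  simp only [h]
  simp

theorem gradient_eq_zero_of_line {Z : Type*} [NormedAddCommGroup Z] [NormedSpace ℝ Z] {n : ℕ}
    {Φ : Z → ℝ} {z : Z} {ι : E n → Z} {e : E n → Z} {p G : E n} (hd : DifferentiableAt ℝ Φ z)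
    (hι : ∀ (v : E n) (t : ℝ), z + t • e v = ι (p + t • v))
    (hG : HasGradientAt (fun q => Φ (ι q)) G p) (h0 : ∀ v, fderiv ℝ Φ z (e v) = 0) : G = 0 := by
  refine ext_inner_right ℝ fun v => ?_
  have h1 := h0 v
  rw [← hd.lineDeriv_eq_fderiv, lineDeriv] at h1
  simp only [hι] at h1
  rw [inner_zero_left, ← h1, ← hG.fderiv_apply, ← hG.differentiableAt.lineDeriv_eq_fderiv, lineDeriv]

theorem grad1_equation (hf : ContDiff ℝ 2 f) (hg : ∀ i, ContDiff ℝ 2 (g i))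
    (h0 : ∀ v, fderiv ℝ (svfLag f g c lam μ mug) (x, y, u, s, a, b) (v, 0, 0, 0, 0, 0) = 0) :
    c • (grad1 f x y - grad1 f x u) + ∑ i, lam i • grad1 (g i) x y
      + grad21 f g s μ x u + ∑ i, mug i • grad1 (g i) x u = 0 := by
  refine gradient_eq_zero_of_line (differentiable_svfLag hf hg c lam μ mug _)
    (ι := fun q => (q, y, u, s, a, b)) (p := x) (fun v t => by simp) ?_ h0
  have hd : ∀ {φ : E d × E l → ℝ}, ContDiff ℝ 2 φ → ∀ y, HasFDerivAt (fun q => φ (q, y))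
      (InnerProductSpace.toDual ℝ (E d) (grad1 φ x y)) x := fun {φ} hφ y => by
    have h1 : DifferentiableAt ℝ (fun q => φ (q, y)) x := by
      have := hφ.differentiable two_ne_zero
      fun_prop
    exact h1.hasGradientAt.hasFDerivAt
  have hL : HasFDerivAt (fun q => ⟪lagGrad f g q u s, μ⟫_ℝ)
      (InnerProductSpace.toDual ℝ (E d) (grad21 f g s μ x u)) x := by
    have h1 : Differentiable ℝ (fun q : E d => lagGrad f g q u s) :=
      ((contDiff_lagGrad hf hg).differentiable one_ne_zero).comp
        (f := fun q : E d => (q, u, s)) (by fun_prop)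
    exact ((h1.inner ℝ (differentiable_const (c := μ))) x).hasGradientAt.hasFDerivAt
  refine hasGradientAt_iff_hasFDerivAt.2 ?_
  have h := (((((hd hf y).sub (hd hf u)).const_mul c).add (HasFDerivAt.fun_sum
    (u := Finset.univ) fun i _ => ((hd (hg i) y).add_const (b i)).const_mul (lam i))).add hL).add
    (HasFDerivAt.fun_sum (u := Finset.univ) fun i _ =>
      ((hd (hg i) u).add_const (a i)).const_mul (mug i))
  refine HasFDerivAt.congr_fderiv h ?_
  simp

theorem grad2_equation_upper (hf : ContDiff ℝ 2 f) (hg : ∀ i, ContDiff ℝ 2 (g i))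
    (h0 : ∀ v, fderiv ℝ (svfLag f g c lam μ mug) (x, y, u, s, a, b) (0, v, 0, 0, 0, 0) = 0) :
    c • grad2 f x y + ∑ i, lam i • grad2 (g i) x y = 0 := by
  refine gradient_eq_zero_of_line (differentiable_svfLag hf hg c lam μ mug _)
    (ι := fun q => (x, q, u, s, a, b)) (p := y) (fun v t => by simp) ?_ h0
  have hd : ∀ {φ : E d × E l → ℝ}, ContDiff ℝ 2 φ → HasFDerivAt (fun q => φ (x, q))
      (InnerProductSpace.toDual ℝ (E l) (grad2 φ x y)) y := fun {φ} hφ => by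
    have h1 : DifferentiableAt ℝ (fun q => φ (x, q)) y := by
      have := hφ.differentiable two_ne_zero
      fun_prop
    exact h1.hasGradientAt.hasFDerivAt
  refine hasGradientAt_iff_hasFDerivAt.2 ?_
  have h := (((((hd hf).sub_const (f (x, u))).const_mul c).add (HasFDerivAt.fun_sum
    (u := Finset.univ) fun i _ => ((hd (hg i)).add_const (b i)).const_mul (lam i))).add_const
    ⟪lagGrad f g x u s, μ⟫_ℝ).add_const (∑ i, mug i * (g i (x, u) + a i))
  refine HasFDerivAt.congr_fderiv h ?_
  simp

theorem grad2_equation_lower (hf : ContDiff ℝ 2 f) (hg : ∀ i, ContDiff ℝ 2 (g i))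
    (h0 : ∀ v, fderiv ℝ (svfLag f g c lam μ mug) (x, y, u, s, a, b) (0, 0, v, 0, 0, 0) = 0) :
    -(c • grad2 f x u) + ∑ i, mug i • grad2 (g i) x u + grad22 f g s μ x u = 0 := by
  refine gradient_eq_zero_of_line (differentiable_svfLag hf hg c lam μ mug _)
    (ι := fun q => (x, y, q, s, a, b)) (p := u) (fun v t => by simp) ?_ h0
  have hd : ∀ {φ : E d × E l → ℝ}, ContDiff ℝ 2 φ → HasFDerivAt (fun q => φ (x, q))
      (InnerProductSpace.toDual ℝ (E l) (grad2 φ x u)) u := fun {φ} hφ => by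
    have h1 : DifferentiableAt ℝ (fun q => φ (x, q)) u := by
      have := hφ.differentiable two_ne_zero
      fun_prop
    exact h1.hasGradientAt.hasFDerivAt
  have hL : HasFDerivAt (fun q => ⟪lagGrad f g x q s, μ⟫_ℝ)
      (InnerProductSpace.toDual ℝ (E l) (grad22 f g s μ x u)) u := by
    have h1 : Differentiable ℝ (fun q : E l => lagGrad f g x q s) :=
      ((contDiff_lagGrad hf hg).differentiable one_ne_zero).comp
        (f := fun q : E l => (x, q, s)) (by fun_prop)
    exact ((h1.inner ℝ (differentiable_const (c := μ))) u).hasGradientAt.hasFDerivAt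
  refine hasGradientAt_iff_hasFDerivAt.2 ?_
  have h := (((((hd hf).const_sub (f (x, y))).const_mul c).add_const
    (∑ i, lam i * (g i (x, y) + b i))).add hL).add
    (HasFDerivAt.fun_sum (u := Finset.univ) fun i _ =>
      ((hd (hg i)).add_const (a i)).const_mul (mug i))
  refine HasFDerivAt.congr_fderiv h ?_
  simp only [map_add, map_neg, map_sum, map_smulₛₗ, conj_trivial, smul_neg]
  abel

theorem fderiv_svfLag_s (hf : ContDiff ℝ 2 f) (hg : ∀ i, ContDiff ℝ 2 (g i))
    (z : SVFSpace d l m) (i : Fin m) :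
    fderiv ℝ (svfLag f g c lam μ mug) z (0, 0, 0, Pi.single i 1, 0, 0) =
      ⟪grad2 (g i) z.1 z.2.2.1, μ⟫_ℝ := by
  refine fderiv_apply_eq_of_line (differentiable_svfLag hf hg c lam μ mug _) fun t => ?_
  simp [svfLag, lagGrad, add_smul, Finset.sum_add_distrib, inner_add_left, Pi.single_apply,
    ite_smul, real_inner_smul_left]
  ring

theorem fderiv_svfLag_a (hf : ContDiff ℝ 2 f) (hg : ∀ i, ContDiff ℝ 2 (g i))
    (z : SVFSpace d l m) (i : Fin m) :
    fderiv ℝ (svfLag f g c lam μ mug) z (0, 0, 0, 0, Pi.single i 1, 0) = mug i := by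
  refine fderiv_apply_eq_of_line (differentiable_svfLag hf hg c lam μ mug _) fun t => ?_
  simp [svfLag, mul_add, Finset.sum_add_distrib, Pi.single_apply]
  ring

theorem fderiv_svfLag_b (hf : ContDiff ℝ 2 f) (hg : ∀ i, ContDiff ℝ 2 (g i))
    (z : SVFSpace d l m) (i : Fin m) :
    fderiv ℝ (svfLag f g c lam μ mug) z (0, 0, 0, 0, 0, Pi.single i 1) = lam i := by
  refine fderiv_apply_eq_of_line (differentiable_svfLag hf hg c lam μ mug _) fun t => ?_
  simp [svfLag, mul_add, Finset.sum_add_distrib, Pi.single_apply]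
  ring

end Smooth

/-- Two-sided feasible directions give vanishing limits of approximate stationarity functionals. -/
theorem eq_zero_of_two_sided {Z : Type*} [NormedAddCommGroup Z] [NormedSpace ℝ Z] {s : Set Z}
    {U : Filter ℕ} [NeBot U] {z : ℕ → Z} {ξ : ℕ → Z →L[ℝ] ℝ} {v : Z} {r : ℝ}
    (hξ : Tendsto (fun k => ξ k v) U (𝓝 r))
    (hstat : ∀ᶠ k in U, ∀ v, (∀ᶠ t : ℝ in 𝓝[>] 0, z k + t • v ∈ s) → 0 ≤ ξ k v)
    (hv : ∀ᶠ k in U, ∀ᶠ t : ℝ in 𝓝 0, z k + t • v ∈ s) : r = 0 := by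
  refine tendsto_nhds_unique_of_eventuallyEq hξ tendsto_const_nhds ?_
  filter_upwards [hstat, hv] with k hk hvk
  refine le_antisymm ?_ (hk v (hvk.filter_mono nhdsWithin_le_nhds))
  have h1 : ∀ᶠ t : ℝ in 𝓝 0, z k + t • -v ∈ s := by
    have h2 : Tendsto (fun t : ℝ => -t) (𝓝 0) (𝓝 0) := by
      simpa using (continuous_neg (G := ℝ)).tendsto 0
    filter_upwards [h2.eventually hvk] with t ht
    simpa using ht
  have h3 := hk (-v) (h1.filter_mono nhdsWithin_le_nhds)
  rw [map_neg] at h3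
  linarith

section Directions

variable {d l m : ℕ} {z : SVFSpace d l m}

theorem svfCone_add_free (hz : z ∈ svfCone d l m) (v : E d) (w w' : E l) (t : ℝ) :
    z + t • ((v, w, w', 0, 0, 0) : SVFSpace d l m) ∈ svfCone d l m := by
  simpa [svfCone] using hz

theorem eventually_nonneg_add {r c : ℝ} (hr : 0 < r) : ∀ᶠ t : ℝ in 𝓝 0, 0 ≤ r + t * c := by
  have h : Continuous fun t : ℝ => r + t * c := by fun_prop
  have h1 := (h.tendsto 0).eventually (lt_mem_nhds (a := 0) (by simpa using hr))
  exact h1.mono fun t ht => ht.le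

theorem svfCone_add_s (hz : z ∈ svfCone d l m) {i : Fin m} (ha : z.2.2.2.2.1 i = 0) {t : ℝ}
    (ht : 0 ≤ z.2.2.2.1 i + t * 1) :
    z + t • ((0, 0, 0, Pi.single i 1, 0, 0) : SVFSpace d l m) ∈ svfCone d l m := by
  intro j
  obtain ⟨h1, h2, h3, h4⟩ := hz j
  rcases eq_or_ne j i with rfl | hj
  · refine ⟨?_, ?_, ?_, ?_⟩ <;> simp_all
  · refine ⟨?_, ?_, ?_, ?_⟩ <;> simp_all

theorem svfCone_add_a (hz : z ∈ svfCone d l m) {i : Fin m} (hs : z.2.2.2.1 i = 0) {t : ℝ}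
    (ht : 0 ≤ z.2.2.2.2.1 i + t * 1) :
    z + t • ((0, 0, 0, 0, Pi.single i 1, 0) : SVFSpace d l m) ∈ svfCone d l m := by
  intro j
  obtain ⟨h1, h2, h3, h4⟩ := hz j
  rcases eq_or_ne j i with rfl | hj
  · refine ⟨?_, ?_, ?_, ?_⟩ <;> simp_all
  · refine ⟨?_, ?_, ?_, ?_⟩ <;> simp_all

theorem svfCone_add_b (hz : z ∈ svfCone d l m) {i : Fin m} {t : ℝ}
    (ht : 0 ≤ z.2.2.2.2.2 i + t * 1) :
    z + t • ((0, 0, 0, 0, 0, Pi.single i 1) : SVFSpace d l m) ∈ svfCone d l m := by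
  intro j
  obtain ⟨h1, h2, h3, h4⟩ := hz j
  rcases eq_or_ne j i with rfl | hj
  · refine ⟨?_, ?_, ?_, ?_⟩ <;> simp_all
  · refine ⟨?_, ?_, ?_, ?_⟩ <;> simp_all

theorem eventually_svfCone_add_s (hz : z ∈ svfCone d l m) {i : Fin m} (hs : 0 < z.2.2.2.1 i) :
    ∀ᶠ t : ℝ in 𝓝 0,
      z + t • ((0, 0, 0, Pi.single i 1, 0, 0) : SVFSpace d l m) ∈ svfCone d l m := by
  filter_upwards [eventually_nonneg_add (c := 1) hs] with t ht
  exact svfCone_add_s hz ((mul_eq_zero.1 (hz i).2.2.1).resolve_left hs.ne') ht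

theorem eventually_svfCone_add_a (hz : z ∈ svfCone d l m) {i : Fin m} (ha : 0 < z.2.2.2.2.1 i) :
    ∀ᶠ t : ℝ in 𝓝 0,
      z + t • ((0, 0, 0, 0, Pi.single i 1, 0) : SVFSpace d l m) ∈ svfCone d l m := by
  filter_upwards [eventually_nonneg_add (c := 1) ha] with t ht
  exact svfCone_add_a hz ((mul_eq_zero.1 (hz i).2.2.1).resolve_right ha.ne') ht

end Directions

theorem isClosed_biactive_signs :
    IsClosed {p : ℝ × ℝ | p.1 * p.2 = 0 ∨ (0 ≤ p.1 ∧ 0 ≤ p.2)} :=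
  (isClosed_eq (continuous_fst.mul continuous_snd) continuous_const).union
    ((isClosed_le continuous_const continuous_fst).inter
      (isClosed_le continuous_const continuous_snd))

/-- At a point of the cone, a functional that is nonnegative along feasible directions has either
nonnegative components along `a i` and `s i`, or one of them vanishes. -/
theorem svfCone_biactive {d l m : ℕ} {z : SVFSpace d l m} (hz : z ∈ svfCone d l m)
    {ξ : SVFSpace d l m →L[ℝ] ℝ}
    (h : ∀ v, (∀ᶠ t : ℝ in 𝓝[>] 0, z + t • v ∈ svfCone d l m) → 0 ≤ ξ v) (i : Fin m) :
    ξ (0, 0, 0, 0, Pi.single i 1, 0) * ξ (0, 0, 0, Pi.single i 1, 0, 0) = 0 ∨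
      (0 ≤ ξ (0, 0, 0, 0, Pi.single i 1, 0) ∧ 0 ≤ ξ (0, 0, 0, Pi.single i 1, 0, 0)) := by
  have hev : ∀ᶠ _ : ℕ in atTop, ∀ v,
      (∀ᶠ t : ℝ in 𝓝[>] 0, z + t • v ∈ svfCone d l m) → 0 ≤ ξ v := Eventually.of_forall fun _ => h
  rcases (hz i).1.eq_or_lt with hs | hs
  · rcases (hz i).2.1.eq_or_lt with ha | ha
    · refine Or.inr ⟨h _ ?_, h _ ?_⟩
      · filter_upwards [self_mem_nhdsWithin] with t ht
        have ht' : (0 : ℝ) < t := ht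
        exact svfCone_add_a hz hs.symm (by linarith)
      · filter_upwards [self_mem_nhdsWithin] with t ht
        have ht' : (0 : ℝ) < t := ht
        exact svfCone_add_s hz ha.symm (by linarith)
    · refine Or.inl (mul_eq_zero_of_left (eq_zero_of_two_sided (z := fun _ => z)
        (ξ := fun _ => ξ) tendsto_const_nhds hev ?_) _)
      exact Eventually.of_forall fun _ => eventually_svfCone_add_a hz ha
  · refine Or.inl (mul_eq_zero_of_right _ (eq_zero_of_two_sided (z := fun _ => z)
        (ξ := fun _ => ξ) tendsto_const_nhds hev ?_))
    exact Eventually.of_forall fun _ => eventually_svfCone_add_s hz hs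

/-- under Assumption (A) (with `f`, `g` twice continuously differentiable),
the MPEC-NNAMCQ fails at every feasible point of SVF: there are multipliers, not all
zero, vanishing off the active index sets, satisfying the abnormal stationarity system
together with the M-type sign conditions on the biactive set `I₀(x̄,ū)`. -/
theorem mpec_nnamcq_fails_for_svf
    {d l m : ℕ} (hd : 0 < d) (hl : 0 < l) (hm : 0 < m)
    (F f : E d × E l → ℝ) (g : Fin m → E d × E l → ℝ)
    (hF : ContDiff ℝ 1 F) (hf : ContDiff ℝ 2 f) (hg : ∀ i, ContDiff ℝ 2 (g i))
    (hA : AssumptionA f g)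
    (xb : E d) (yb ub : E l) (sb : Fin m → ℝ)
    (hfeas : FSmem f g xb yb ub sb) :
    ∃ (lam0 : ℝ) (lam : Fin m → ℝ) (muphi : E l) (mug : Fin m → ℝ),
      0 ≤ lam0 ∧ (∀ i, 0 ≤ lam i) ∧
      (∀ i, g i (xb, yb) ≠ 0 → lam i = 0) ∧
      (∀ i, g i (xb, ub) ≠ 0 → mug i = 0) ∧
      ¬(lam0 = 0 ∧ lam = 0 ∧ muphi = 0 ∧ mug = 0) ∧
      (lam0 • (grad1 f xb yb - grad1 f xb ub) + ∑ i, lam i • grad1 (g i) xb yb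
        + grad21 f g sb muphi xb ub + ∑ i, mug i • grad1 (g i) xb ub = 0) ∧
      (lam0 • grad2 f xb yb + ∑ i, lam i • grad2 (g i) xb yb = 0) ∧
      (-(lam0 • grad2 f xb ub) + ∑ i, mug i • grad2 (g i) xb ub
        + grad22 f g sb muphi xb ub = 0) ∧
      (∀ i, g i (xb, ub) = 0 → 0 < sb i → ⟪grad2 (g i) xb ub, muphi⟫_ℝ = 0) ∧
      (∀ i, g i (xb, ub) = 0 → sb i = 0 →
        (0 < mug i ∧ 0 < ⟪grad2 (g i) xb ub, muphi⟫_ℝ) ∨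
        mug i * ⟪grad2 (g i) xb ub, muphi⟫_ℝ = 0) := by
  have hobj : ContDiff ℝ 1 (fun z : SVFSpace d l m => f (z.1, z.2.1) - f (z.1, z.2.2.1)) := by
    have := hf.of_le one_le_two
    fun_prop
  obtain ⟨hval, hkkt, hy⟩ := hfeas
  set zb : SVFSpace d l m := (xb, yb, ub, sb, fun i => -g i (xb, ub), fun i => -g i (xb, yb))
    with hzb_def
  have hzb : zb ∈ svfCone d l m := fun i =>
    ⟨(hkkt.2 i).1, by simpa [hzb_def] using (hkkt.2 i).2.1, by simpa [hzb_def] using (hkkt.2 i).2.2,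
      by simpa [hzb_def] using hy i⟩
  have hconstr : ∀ k, svfConstraint f g k zb = 0 := by
    rintro (j | i | i)
    · simp [svfConstraint, hzb_def, lagGrad, hkkt.1]
    · simp [svfConstraint, hzb_def]
    · simp [svfConstraint, hzb_def]
  have hmin : ∀ z ∈ svfCone d l m, (∀ k, svfConstraint f g k z = 0) →
      f (zb.1, zb.2.1) - f (zb.1, zb.2.2.1) ≤ f (z.1, z.2.1) - f (z.1, z.2.2.1) := by
    intro z hz hk
    have h1 : ∀ i, g i (z.1, z.2.2.1) = -z.2.2.2.2.1 i := fun i =>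
      eq_neg_of_add_eq_zero_left (hk (.inr (.inl i)))
    have h2 : ∀ i, g i (z.1, z.2.1) = -z.2.2.2.2.2 i := fun i =>
      eq_neg_of_add_eq_zero_left (hk (.inr (.inr i)))
    have h3 : LLKKT f g z.1 z.2.2.1 z.2.2.2.1 := by
      refine ⟨?_, fun i => ⟨(hz i).1, ?_, ?_⟩⟩
      · ext j
        exact hk (.inl j)
      · rw [h1]
        exact neg_nonpos.2 (hz i).2.1
      · rw [h1, mul_neg, (hz i).2.2.1, neg_zero]
    have h4 : f (z.1, z.2.2.1) ≤ f (z.1, z.2.1) := hA.le_of_llkkt hf hg h3 fun i => by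
      rw [h2]
      exact neg_nonpos.2 (hz i).2.2.2
    exact hval.trans (sub_nonneg.2 h4)
  obtain ⟨c, w, U, z, ξ, hc, hcw, hz, hzs, hξ, hstat⟩ := exists_fritzJohn_multipliers hobj
    (contDiff_svfConstraint hf hg) (isClosed_svfCone d l m) hzb hconstr hmin
  rw [svfLag_eq] at hξ
  set lam : Fin m → ℝ := fun i => w (.inr (.inr i)) with hlam
  set μ : E l := WithLp.toLp 2 fun j => w (.inl j) with hμ
  set mug : Fin m → ℝ := fun i => w (.inr (.inl i)) with hmug
  have hfree : ∀ (v : E d) (w₁ w₂ : E l),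
      fderiv ℝ (svfLag f g c lam μ mug) zb (v, w₁, w₂, 0, 0, 0) = 0 := fun v w₁ w₂ =>
    eq_zero_of_two_sided (hξ _) hstat (Eventually.of_forall fun k => Eventually.of_forall fun t =>
      svfCone_add_free (hzs k) v w₁ w₂ t)
  have hξs : ∀ i, Tendsto (fun k => ξ k (0, 0, 0, Pi.single i 1, 0, 0)) U
      (𝓝 ⟪grad2 (g i) xb ub, μ⟫_ℝ) := fun i => by
    have h := hξ (0, 0, 0, Pi.single i 1, 0, 0)
    rwa [fderiv_svfLag_s hf hg] at h
  have hξa : ∀ i, Tendsto (fun k => ξ k (0, 0, 0, 0, Pi.single i 1, 0)) U (𝓝 (mug i)) :=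
    fun i => by
      have h := hξ (0, 0, 0, 0, Pi.single i 1, 0)
      rwa [fderiv_svfLag_a hf hg] at h
  have hξb : ∀ i, Tendsto (fun k => ξ k (0, 0, 0, 0, 0, Pi.single i 1)) U (𝓝 (lam i)) :=
    fun i => by
      have h := hξ (0, 0, 0, 0, 0, Pi.single i 1)
      rwa [fderiv_svfLag_b hf hg] at h
  have hpos : ∀ {φ : SVFSpace d l m → ℝ}, Continuous φ → 0 < φ zb → ∀ᶠ k in U, 0 < φ (z k) :=
    fun hφ h0 => ((hφ.tendsto zb).comp hz).eventually (lt_mem_nhds h0)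
  refine ⟨c, lam, μ, mug, hc, fun i => ?_, fun i hi => ?_, fun i hi => ?_, ?_,
    grad1_equation hf hg fun v => hfree v 0 0, grad2_equation_upper hf hg fun v => hfree 0 v 0,
    grad2_equation_lower hf hg fun v => hfree 0 0 v, fun i _ hi => ?_, fun i _ _ => ?_⟩
  · refine ge_of_tendsto (hξb i) (hstat.mono fun k hk => hk _ ?_)
    filter_upwards [self_mem_nhdsWithin] with t ht
    have ht' : (0 : ℝ) < t := ht
    exact svfCone_add_b (hzs k) (by linarith [(hzs k i).2.2.2])
  · refine eq_zero_of_two_sided (hξb i) hstat ?_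
    have hb : 0 < zb.2.2.2.2.2 i := neg_pos.2 (lt_of_le_of_ne (hy i) hi)
    filter_upwards [hpos (φ := fun z => z.2.2.2.2.2 i) (by fun_prop) hb] with k hk
    exact (eventually_nonneg_add (c := 1) hk).mono fun t ht => svfCone_add_b (hzs k) ht
  · refine eq_zero_of_two_sided (hξa i) hstat ?_
    have ha : 0 < zb.2.2.2.2.1 i := neg_pos.2 (lt_of_le_of_ne (hkkt.2 i).2.1 hi)
    filter_upwards [hpos (φ := fun z => z.2.2.2.2.1 i) (by fun_prop) ha] with k hk
    exact eventually_svfCone_add_a (hzs k) hk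
  · rintro ⟨h1, h2, h3, h4⟩
    refine hcw (Prod.ext h1 (funext ?_))
    rintro (j | i | i)
    · exact congrArg (fun v : E l => v j) h3
    · exact congrFun h4 i
    · exact congrFun h2 i
  · refine eq_zero_of_two_sided (hξs i) hstat ?_
    filter_upwards [hpos (φ := fun z => z.2.2.2.1 i) (by fun_prop) hi] with k hk
    exact eventually_svfCone_add_s (hzs k) hk
  · have hmem := isClosed_biactive_signs.mem_of_tendsto ((hξa i).prodMk_nhds (hξs i))
      (hstat.mono fun k hk => svfCone_biactive (hzs k) hk i)
    rcases hmem with h0 | ⟨h1, h2⟩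
    · exact Or.inr h0
    · rcases h1.eq_or_lt with h1 | h1
      · exact Or.inr (mul_eq_zero_of_left h1.symm _)
      rcases h2.eq_or_lt with h2 | h2
      · exact Or.inr (mul_eq_zero_of_right _ h2.symm)
      exact Or.inl ⟨h1, h2⟩
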